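/- Let l be a positive integer and let m be an integer with m ≥ 2^(2l+2) − 1. Then there do not exist sets C, D ⊆ ℕ with C ∪ D = ℕ, 0 ∈ C, and C ∩ D = ((2^(2l+1) − 2) + mℕ) ∪ ((2^(2l+1) − 1) + mℕ) such that R_C(n) = R_D(n) for all n ∈ ℕ. -/

import Mathlib

/-- `R S n` is the number of pairs `(s, s')` with `s, s' ∈ S`, `s < s'` and `s + s' = n`. -/
noncomputable def R (S : Set ℕ) (n : ℕ) : ℕ :=
  Set.ncard {p : ℕ × ℕ | p.1 ∈ S ∧ p.2 ∈ S ∧ p.1 < p.2 ∧ p.1 + p.2 = n}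

/-- `AP r m` is the arithmetic progression `r + mℕ = {r + m*k : k ∈ ℕ}`. -/
def AP (r m : ℕ) : Set ℕ := {n | ∃ k : ℕ, n = r + m * k}

open Finset PowerSeries

/-- The integer-valued indicator sequence of a set of natural numbers. -/
noncomputable def ind (S : Set ℕ) (n : ℕ) : ℤ := S.indicator 1 n

/-- The coefficient sequence of `F(x²)`, where `F` has coefficient sequence `f`. -/
def dilate (f : ℕ → ℤ) (n : ℕ) : ℤ := if Even n then f (n / 2) else 0

lemma dilate_two_mul (f : ℕ → ℤ) (n : ℕ) : dilate f (2 * n) = f n := by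
  simp [dilate]

lemma dilate_two_mul_add_one (f : ℕ → ℤ) (n : ℕ) : dilate f (2 * n + 1) = 0 := by
  simp [dilate]

lemma ind_of_mem {S : Set ℕ} {n : ℕ} (h : n ∈ S) : ind S n = 1 := by
  simp [ind, h]

lemma ind_of_notMem {S : Set ℕ} {n : ℕ} (h : n ∉ S) : ind S n = 0 := by
  simp [ind, h]

lemma sum_antidiagonal_ind (S : Set ℕ) (n : ℕ) :
    ∑ p ∈ antidiagonal n, ind S p.1 * ind S p.2 = 2 * R S n + dilate (ind S) n := by
  classical
  have hR : (R S n : ℤ) =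
      ∑ p ∈ antidiagonal n, if p.1 < p.2 then ind S p.1 * ind S p.2 else 0 := by
    have hset : {p : ℕ × ℕ | p.1 ∈ S ∧ p.2 ∈ S ∧ p.1 < p.2 ∧ p.1 + p.2 = n} =
        ((antidiagonal n).filter fun p => p.1 ∈ S ∧ p.2 ∈ S ∧ p.1 < p.2 : Finset (ℕ × ℕ)) := by
      ext p
      simp only [Set.mem_ofPred_eq, coe_filter, HasAntidiagonal.mem_antidiagonal]
      tauto
    rw [R, hset, Set.ncard_coe_finset, card_filter]
    push_cast
    refine sum_congr rfl fun p _ => ?_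
    by_cases h₁ : p.1 ∈ S <;> by_cases h₂ : p.2 ∈ S <;> simp [ind, h₁, h₂]
  have hswap : (R S n : ℤ) =
      ∑ p ∈ antidiagonal n, if p.2 < p.1 then ind S p.1 * ind S p.2 else 0 := by
    rw [hR, ← Nat.sum_antidiagonal_swap]
    refine sum_congr rfl fun p _ => ?_
    simp [mul_comm]
  have hdiag : dilate (ind S) n =
      ∑ p ∈ antidiagonal n, if p.1 = p.2 then ind S p.1 * ind S p.2 else 0 := by
    have hsq (k : ℕ) : ind S k * ind S k = ind S k := by
      by_cases h : k ∈ S <;> simp [ind, h]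
    rcases Nat.even_or_odd' n with ⟨k, rfl | rfl⟩
    · rw [dilate_two_mul, sum_eq_single (k, k)]
      · simp [hsq]
      · rintro ⟨a, b⟩ hp hne
        rw [HasAntidiagonal.mem_antidiagonal] at hp
        rw [if_neg]
        rintro h
        apply hne
        simp only at h hp
        ext <;> simp only <;> omega
      · intro h
        exact absurd (HasAntidiagonal.mem_antidiagonal.2 (by simp; omega)) h
    · rw [dilate_two_mul_add_one, sum_eq_zero]
      rintro ⟨a, b⟩ hp
      rw [HasAntidiagonal.mem_antidiagonal] at hp
      rw [if_neg]
      simp only at hp ⊢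
      omega
  rw [two_mul]
  nth_rw 1 [hR]
  rw [hswap, hdiag, ← sum_add_distrib, ← sum_add_distrib]
  refine sum_congr rfl fun p _ => ?_
  rcases lt_trichotomy p.1 p.2 with h | h | h
  · simp [h, h.ne, h.not_gt]
  · simp [h]
  · simp [h, h.ne', h.not_gt]

lemma ind_AP_mul_one_sub {r m : ℕ} (hrm : r < m) :
    PowerSeries.mk (ind (AP r m)) * (1 - X ^ m) = X ^ r := by
  ext n
  rw [mul_sub, mul_one, map_sub, coeff_mul_X_pow', coeff_X_pow, coeff_mk]
  by_cases hmn : m ≤ n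
  · have hiff : n ∈ AP r m ↔ n - m ∈ AP r m := by
      constructor
      · rintro ⟨_ | k, hk⟩
        · omega
        · exact ⟨k, by rw [mul_add, mul_one] at hk; omega⟩
      · rintro ⟨k, hk⟩
        exact ⟨k + 1, by rw [mul_add, mul_one]; omega⟩
    rw [if_pos hmn, if_neg (by omega), coeff_mk]
    by_cases h : n ∈ AP r m
    · rw [ind_of_mem h, ind_of_mem (hiff.1 h), sub_self]
    · rw [ind_of_notMem h, ind_of_notMem (mt hiff.2 h), sub_self]
  · rw [if_neg hmn, sub_zero]
    split_ifs with h
    · exact ind_of_mem ⟨0, by simp [h]⟩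
    · refine ind_of_notMem ?_
      rintro ⟨_ | k, hk⟩
      · simp at hk; omega
      · rw [mul_add, mul_one] at hk; omega

lemma disjoint_AP_succ {r m : ℕ} (hrm : r + 1 < m) : Disjoint (AP r m) (AP (r + 1) m) := by
  rw [Set.disjoint_left]
  rintro n ⟨k, hk⟩ ⟨j, hj⟩
  have := congrArg (· % m) (hk.symm.trans hj)
  simp only [Nat.add_mul_mod_self_left] at this
  rw [Nat.mod_eq_of_lt (by omega), Nat.mod_eq_of_lt hrm] at this
  omega

lemma ind_add_ind {C D : Set ℕ} {r m : ℕ} (hrm : r + 1 < m) (hU : C ∪ D = Set.univ)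
    (hI : C ∩ D = AP r m ∪ AP (r + 1) m) (n : ℕ) :
    ind C n + ind D n = 1 + ind (AP r m) n + ind (AP (r + 1) m) n := by
  have h₁ := congrFun (Set.indicator_union_add_inter (1 : ℕ → ℤ) C D) n
  have h₂ := congrFun (Set.indicator_union_of_disjoint (disjoint_AP_succ hrm) (1 : ℕ → ℤ)) n
  rw [hU, hI] at h₁
  simp only [Pi.add_apply, Set.indicator_univ, Pi.one_apply] at h₁
  simp only [ind]
  rw [← h₁, h₂, add_assoc]

lemma ind_sub_ind_recurrence {C D : Set ℕ} {r m : ℕ} (hrm : r + 1 < m) (hU : C ∪ D = Set.univ)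
    (hI : C ∩ D = AP r m ∪ AP (r + 1) m) (hR : ∀ n, R C n = R D n) (f : ℕ → ℤ)
    (hf : ∀ n, f n = ind C n - ind D n) (n : ℕ) :
    f n - (if m ≤ n then f (n - m) else 0) + (if r ≤ n then f (n - r) else 0)
        - (if r + 2 ≤ n then f (n - (r + 2)) else 0) =
      dilate f n - (if 1 ≤ n then dilate f (n - 1) else 0)
        - (if m ≤ n then dilate f (n - m) else 0)
        + (if m + 1 ≤ n then dilate f (n - (m + 1)) else 0) := by
  have hfac : PowerSeries.mk f * (PowerSeries.mk (ind C) + PowerSeries.mk (ind D)) =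
      PowerSeries.mk (dilate f) := by
    have hF : PowerSeries.mk f = PowerSeries.mk (ind C) - PowerSeries.mk (ind D) := by
      ext k; simp [hf]
    have : PowerSeries.mk (ind C) * PowerSeries.mk (ind C)
        - PowerSeries.mk (ind D) * PowerSeries.mk (ind D) = PowerSeries.mk (dilate f) := by
      ext k
      simp only [map_sub, coeff_mul, coeff_mk, sum_antidiagonal_ind, hR, dilate]
      split_ifs <;> simp [hf]
    rw [hF, ← this]
    ring
  have hsum : PowerSeries.mk (ind C) + PowerSeries.mk (ind D) =
      PowerSeries.mk 1 + PowerSeries.mk (ind (AP r m)) + PowerSeries.mk (ind (AP (r + 1) m)) := by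
    ext k
    simpa using ind_add_ind hrm hU hI k
  have h₁ : (PowerSeries.mk 1 : ℤ⟦X⟧) * (1 - X) = 1 := mk_one_mul_one_sub_eq_one ℤ
  have h₂ := ind_AP_mul_one_sub (show r < m by omega)
  have h₃ := ind_AP_mul_one_sub hrm
  have key : PowerSeries.mk f - PowerSeries.mk f * X ^ m + PowerSeries.mk f * X ^ r
      - PowerSeries.mk f * X ^ (r + 2) =
      PowerSeries.mk (dilate f) - PowerSeries.mk (dilate f) * X ^ 1
        - PowerSeries.mk (dilate f) * X ^ m + PowerSeries.mk (dilate f) * X ^ (m + 1) := by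
    rw [← hfac, hsum]
    linear_combination (-(PowerSeries.mk f * (1 - X ^ m))) * h₁
      - PowerSeries.mk f * (1 - X) * h₂ - PowerSeries.mk f * (1 - X) * h₃
  simpa only [map_sub, map_add, coeff_mul_X_pow', coeff_mk] using congrArg (coeff n) key

lemma not_recurrence {l m r N : ℕ} (hl : 0 < l) (hN : N = 2 ^ (2 * l + 1)) (hr : r + 2 = N)
    (hm : 2 * N ≤ m + 1) (f : ℕ → ℤ) (hf : ∀ n, |f n| ≤ 1) (hf0 : f 0 = 1)
    (hfr : f r = 0) (hfr' : f (r + 1) = 0)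
    (hrec : ∀ n, f n - (if m ≤ n then f (n - m) else 0) + (if r ≤ n then f (n - r) else 0)
        - (if r + 2 ≤ n then f (n - (r + 2)) else 0) =
      dilate f n - (if 1 ≤ n then dilate f (n - 1) else 0)
        - (if m ≤ n then dilate f (n - m) else 0)
        + (if m + 1 ≤ n then dilate f (n - (m + 1)) else 0)) : False := by
  obtain ⟨k, rfl⟩ : ∃ k, l = k + 1 := ⟨l - 1, by omega⟩
  obtain ⟨q, hq⟩ : ∃ q, q = 2 ^ (2 * k) := ⟨_, rfl⟩
  have hq1 : 1 ≤ q := hq ▸ Nat.one_le_two_pow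
  have hNq : N = 8 * q := by rw [hN, hq]; ring
  have hlow (n : ℕ) (h₁ : 1 ≤ n) (h₂ : n < m) : f n = dilate f n - dilate f (n - 1)
      - (if r ≤ n then f (n - r) else 0) + (if r + 2 ≤ n then f (n - (r + 2)) else 0) := by
    have h := hrec n
    rw [if_neg (show ¬ m ≤ n by omega), if_neg (show ¬ m + 1 ≤ n by omega), if_pos h₁,
      if_neg (show ¬ m ≤ n by omega)] at h
    linarith
  have hdil (n : ℕ) (hn : 1 ≤ n) : dilate f (2 * n - 1) = 0 := by
    rw [show 2 * n - 1 = 2 * (n - 1) + 1 by omega, dilate_two_mul_add_one]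
  have heven' (n : ℕ) (h₁ : r + 2 ≤ 2 * n) (h₂ : 2 * n < m) :
      f (2 * n) = f n - f (2 * n - r) + f (2 * n - (r + 2)) := by
    rw [hlow _ (by omega) h₂, if_pos (by omega), if_pos h₁, dilate_two_mul, hdil n (by omega),
      sub_zero]
  have hodd' (n : ℕ) (h₁ : r + 2 ≤ 2 * n + 1) (h₂ : 2 * n + 1 < m) :
      f (2 * n + 1) = -f n - f (2 * n + 1 - r) + f (2 * n + 1 - (r + 2)) := by
    rw [hlow _ (by omega) h₂, if_pos (by omega), if_pos h₁, dilate_two_mul_add_one,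
      Nat.add_sub_cancel, dilate_two_mul, zero_sub]
  have hthue (n : ℕ) (h₁ : 1 ≤ n) (h₂ : n < r) : f n = dilate f n - dilate f (n - 1) := by
    rw [hlow n h₁ (by omega), if_neg (by omega), if_neg (by omega), sub_zero, add_zero]
  have heven (n : ℕ) (h₁ : 1 ≤ n) (h₂ : 2 * n < r) : f (2 * n) = f n := by
    rw [hthue _ (by omega) h₂, dilate_two_mul, hdil n h₁, sub_zero]
  have hodd (n : ℕ) (hn : 2 * n + 1 < r) : f (2 * n + 1) = -f n := by
    rw [hthue _ (by omega) hn, dilate_two_mul_add_one, Nat.add_sub_cancel, dilate_two_mul,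
      zero_sub]
  have hf1 : f 1 = -1 := by rw [← hf0]; exact hodd 0 (by omega)
  have hf2 : f 2 = -1 := by rw [← hf1]; exact heven 1 (by omega) (by omega)
  have hf4 : f 4 = -1 := by rw [← hf2]; exact heven 2 (by omega) (by omega)
  have hpow (i : ℕ) (hi : 2 ^ i < r) : f (2 ^ i) = -1 := by
    induction i with
    | zero => exact hf1
    | succ i ih =>
      rw [pow_succ'] at hi ⊢
      rw [heven _ Nat.one_le_two_pow hi, ih (by omega)]
  have hones (i : ℕ) (hi : 2 ^ i < r + 1) : f (2 ^ i - 1) = (-1) ^ i := by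
    induction i with
    | zero => exact hf0
    | succ i ih =>
      have := Nat.one_le_two_pow (n := i)
      rw [pow_succ'] at hi
      rw [pow_succ', show 2 * 2 ^ i - 1 = 2 * (2 ^ i - 1) + 1 by omega, hodd _ (by omega),
        ih (by omega), pow_succ]
      ring
  have hthree (i : ℕ) (hi : 3 * 2 ^ i < r + 1) : f (3 * 2 ^ i - 1) = (-1) ^ (i + 1) := by
    induction i with
    | zero => simpa using hf2
    | succ i ih =>
      have := Nat.one_le_two_pow (n := i)
      rw [pow_succ'] at hi
      rw [pow_succ', show 3 * (2 * 2 ^ i) - 1 = 2 * (3 * 2 ^ i - 1) + 1 by omega,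
        hodd _ (by omega), ih (by omega), pow_succ _ (i + 1)]
      ring
  have hq2 : 2 ^ (2 * k + 1) = 2 * q := by rw [hq]; ring
  have hq4 : 2 ^ (2 * k + 2) = 4 * q := by rw [hq]; ring
  have hhalf : f (4 * q) = -1 := by rw [← hq4]; exact hpow _ (by omega)
  have hquarter : f (2 * q) = -1 := by rw [← hq2]; exact hpow _ (by omega)
  have hhalf_succ : f (4 * q + 1) = 1 := by
    rw [show 4 * q + 1 = 2 * (2 * q) + 1 by ring, hodd _ (by omega), hquarter, neg_neg]
  have hhalf_pred : f (4 * q - 1) = 1 := by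
    rw [← hq4, hones _ (by omega)]
    exact Even.neg_one_pow ⟨k + 1, by ring⟩
  have hthree_quarters : f (6 * q - 1) = 1 := by
    rw [show 6 * q = 3 * 2 ^ (2 * k + 1) by omega, hthree _ (by omega)]
    exact Even.neg_one_pow ⟨k + 1, by ring⟩
  have hN₀ : f (8 * q) = 1 := by
    have h := heven' (4 * q) (by omega) (by omega)
    rw [show 2 * (4 * q) - r = 2 by omega, show 2 * (4 * q) - (r + 2) = 0 by omega, hhalf, hf2,
      hf0, show 2 * (4 * q) = 8 * q by ring] at h
    linarith
  have hN₂ : f (8 * q + 2) = 1 := by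
    have h := heven' (4 * q + 1) (by omega) (by omega)
    rw [show 2 * (4 * q + 1) - r = 4 by omega, show 2 * (4 * q + 1) - (r + 2) = 2 by omega,
      hhalf_succ, hf4, hf2, show 2 * (4 * q + 1) = 8 * q + 2 by ring] at h
    linarith
  have hmid : f (12 * q - 1) = -1 := by
    have h := hodd' (6 * q - 1) (by omega) (by omega)
    rw [show 2 * (6 * q - 1) + 1 - r = 4 * q + 1 by omega,
      show 2 * (6 * q - 1) + 1 - (r + 2) = 4 * q - 1 by omega, hthree_quarters, hhalf_succ,
      hhalf_pred, show 2 * (6 * q - 1) + 1 = 12 * q - 1 by omega] at h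
    linarith
  have h2N_pred : f (16 * q - 2) = -1 := by
    have h := heven' (8 * q - 1) (by omega) (by omega)
    rw [show 2 * (8 * q - 1) - r = 8 * q by omega, show 2 * (8 * q - 1) - (r + 2) = r by omega,
      show 8 * q - 1 = r + 1 by omega, hfr', hfr, hN₀,
      show 2 * (r + 1) = 16 * q - 2 by omega] at h
    linarith
  have hlarge (n : ℕ) (hn : r + 2 ≤ 2 * n) : f (2 * n) = f n - f (2 * n - r)
      + f (2 * n - (r + 2)) + (if m ≤ 2 * n then f (2 * n - m) - dilate f (2 * n - m) else 0)
      + (if m + 1 ≤ 2 * n then dilate f (2 * n - (m + 1)) else 0) := by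
    have h := hrec (2 * n)
    rw [if_pos (show r ≤ 2 * n by omega), if_pos hn, if_pos (show 1 ≤ 2 * n by omega),
      dilate_two_mul, hdil n (by omega)] at h
    split_ifs at h ⊢ <;> linarith
  have h2N : f (16 * q) = 1 := by
    have h := hlarge (8 * q) (by omega)
    rw [show 2 * (8 * q) = 16 * q by ring, show 16 * q - r = 8 * q + 2 by omega,
      show 16 * q - (r + 2) = 8 * q by omega, hN₀, hN₂] at h
    have hd0 : dilate f 0 = 1 := hf0
    have hd1 : dilate f 1 = 0 := dilate_two_mul_add_one f 0
    rcases (show 16 * q < m ∨ 16 * q = m ∨ 16 * q = m + 1 by omega) with hc | hc | hc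
    · rw [if_neg (by omega), if_neg (by omega)] at h
      linarith
    · rw [if_pos (by omega), if_neg (by omega), show 16 * q - m = 0 by omega, hf0, hd0] at h
      linarith
    · rw [if_pos (by omega), if_pos (by omega), show 16 * q - m = 1 by omega,
        show 16 * q - (m + 1) = 0 by omega, hf1, hd0, hd1] at h
      linarith
  have hbound (n : ℕ) (hn : n ≤ r + 1) :
      f n - dilate f n + (if 1 ≤ n then dilate f (n - 1) else 0) ≤ 1 := by
    rcases Nat.eq_zero_or_pos n with rfl | hpos
    · simp [dilate]
    rw [if_pos (show 1 ≤ n from hpos)]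
    rcases (show n < r ∨ n = r ∨ n = r + 1 by omega) with hc | hc | hc
    · rw [hthue n hpos hc]
      linarith
    · have h := abs_le.1 (hf (4 * q - 1))
      rw [hc, hfr, show r = 2 * (4 * q - 1) by omega, dilate_two_mul, hdil _ (by omega)]
      linarith
    · have h := abs_le.1 (hf (4 * q - 1))
      rw [hc, hfr', Nat.add_sub_cancel, show r = 2 * (4 * q - 1) by omega, dilate_two_mul,
        dilate_two_mul_add_one]
      linarith
  have hfinal := hlarge (12 * q - 1) (by omega)
  have hcorr := hbound (2 * (12 * q - 1) - m) (by omega)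
  have habs := abs_le.1 (hf (2 * (12 * q - 1)))
  rw [show 2 * (12 * q - 1) - r = 16 * q by omega,
    show 2 * (12 * q - 1) - (r + 2) = 16 * q - 2 by omega, hmid, h2N, h2N_pred] at hfinal
  by_cases hc : m + 1 ≤ 2 * (12 * q - 1)
  · rw [if_pos (by omega), if_pos hc] at hfinal
    rw [if_pos (by omega), Nat.sub_sub] at hcorr
    linarith
  · rw [if_neg hc] at hfinal
    split_ifs at hfinal with hc'
    · rw [if_neg (by omega)] at hcorr
      linarith
    · linarith

theorem stmt_13 (l : ℕ) (hl : 0 < l) (m : ℕ) (hm : 2 ^ (2 * l + 2) - 1 ≤ m) :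
    ¬ ∃ C D : Set ℕ, C ∪ D = Set.univ ∧ 0 ∈ C ∧
      C ∩ D = AP (2 ^ (2 * l + 1) - 2) m ∪ AP (2 ^ (2 * l + 1) - 1) m ∧
      ∀ n : ℕ, R C n = R D n := by
  rintro ⟨C, D, hU, h0, hI, hR⟩
  obtain ⟨N, hN⟩ : ∃ N, N = 2 ^ (2 * l + 1) := ⟨_, rfl⟩
  have hN8 : 8 ≤ N := hN ▸ Nat.pow_le_pow_right (n := 2) (by norm_num) (show 3 ≤ 2 * l + 1 by omega)
  obtain ⟨r, hr⟩ : ∃ r, r + 2 = N := ⟨N - 2, by omega⟩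
  have hm' : 2 * N ≤ m + 1 := by
    rw [show 2 * l + 2 = (2 * l + 1) + 1 by ring, pow_succ, ← hN] at hm
    omega
  rw [← hN, ← hr, Nat.add_sub_cancel, show r + 2 - 1 = r + 1 by omega] at hI
  have hrm : r + 1 < m := by omega
  have hmem (n : ℕ) (hn : n ∈ AP r m ∪ AP (r + 1) m) : ind C n - ind D n = 0 := by
    rw [← hI] at hn
    rw [ind_of_mem hn.1, ind_of_mem hn.2, sub_self]
  refine not_recurrence hl hN hr hm' (fun n => ind C n - ind D n) (fun n => ?_) ?_
    (hmem r (Or.inl ⟨0, by simp⟩)) (hmem (r + 1) (Or.inr ⟨0, by simp⟩))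
    (ind_sub_ind_recurrence hrm hU hI hR _ fun _ => rfl)
  · by_cases h₁ : n ∈ C <;> by_cases h₂ : n ∈ D <;> simp [ind, h₁, h₂]
  · have hD : 0 ∉ D := fun h => by
      have : 0 ∈ C ∩ D := ⟨h0, h⟩
      rw [hI] at this
      rcases this with ⟨k, hk⟩ | ⟨k, hk⟩ <;> omega
    rw [ind_of_mem h0, ind_of_notMem hD, sub_zero]
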